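/- Let R be a commutative Noetherian local ring and A a ring with R[X] ⊆ A ⊆ R[X, X⁻¹]. Let P, Q be finitely generated projective A-modules of constant rank with P_f ≅ Q_f for some special monic polynomial f ∈ R[X]. Then P and Q have the same minimal number of generators. -/

import Mathlib

set_option synthInstance.maxHeartbeats 1000000
set_option maxHeartbeats 1000000

open Polynomial

/-- A polynomial is special monic if it is monic and has constant term `1`. -/
def IsSpecialMonic {R : Type*} [CommRing R] (f : R[X]) : Prop :=
  f.Monic ∧ f.coeff 0 = 1

/-- A module has constant rank `n` if its localization at every prime has rank `n`. -/
def HasConstRank (A : Type*) [CommRing A] (M : Type*) [AddCommGroup M] [Module A M]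
    (n : ℕ) : Prop :=
  ∀ (𝔭 : Ideal A) [𝔭.IsPrime],
    Module.finrank (Localization.AtPrime 𝔭) (LocalizedModule 𝔭.primeCompl M) = n

/-- The minimal number of generators of a module: the least `n` such that some `n`
elements generate it. -/
noncomputable def minGenerators (A : Type*) [CommRing A] (M : Type*) [AddCommGroup M]
    [Module A M] : ℕ :=
  sInf {n : ℕ | ∃ v : Fin n → M, Submodule.span A (Set.range v) = ⊤}

section

open IsLocalRing

/-- An isomorphism of localizations at `S` clears denominators to a pair of maps whose two
composites are multiplication by one element of `S`. -/
theorem exists_hom_comp_eq_smul_id {A P Q : Type*} [CommRing A] [AddCommGroup P] [Module A P]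
    [Module.FinitePresentation A P] [AddCommGroup Q] [Module A Q] [Module.FinitePresentation A Q]
    (S : Submonoid A) (e : LocalizedModule S P ≃ₗ[A] LocalizedModule S Q) :
    ∃ s ∈ S, ∃ (φ : P →ₗ[A] Q) (ψ : Q →ₗ[A] P),
      (∀ p, ψ (φ p) = s • p) ∧ ∀ q, φ (ψ q) = s • q := by
  let ιP := LocalizedModule.mkLinearMap S P
  let ιQ := LocalizedModule.mkLinearMap S Q
  obtain ⟨φ, a, hφ⟩ := Module.FinitePresentation.exists_lift_of_isLocalizedModule S ιQ
    (e.toLinearMap ∘ₗ ιP)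
  obtain ⟨ψ, b, hψ⟩ := Module.FinitePresentation.exists_lift_of_isLocalizedModule S ιP
    (e.symm.toLinearMap ∘ₗ ιQ)
  have hφ' : ∀ p, ιQ (φ p) = (a : A) • e (ιP p) := fun p ↦ LinearMap.congr_fun hφ p
  have hψ' : ∀ q, ιP (ψ q) = (b : A) • e.symm (ιQ q) := fun q ↦ LinearMap.congr_fun hψ q
  have h₁ : ιP ∘ₗ (ψ ∘ₗ φ) = ιP ∘ₗ ((a * b : A) • LinearMap.id) := by
    ext p
    simp [hφ', hψ', smul_smul, mul_comm]
  have h₂ : ιQ ∘ₗ (φ ∘ₗ ψ) = ιQ ∘ₗ ((a * b : A) • LinearMap.id) := by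
    ext p
    simp [hφ', hψ', smul_smul]
  obtain ⟨c, hc⟩ := Module.Finite.exists_smul_of_comp_eq_of_isLocalizedModule S ιP _ _ h₁
  obtain ⟨d, hd⟩ := Module.Finite.exists_smul_of_comp_eq_of_isLocalizedModule S ιQ _ _ h₂
  have hc' : ∀ p, (c : A) • ψ (φ p) = (c : A) • (a * b : A) • p := fun p ↦ LinearMap.congr_fun hc p
  have hd' : ∀ p, (d : A) • φ (ψ p) = (d : A) • (a * b : A) • p := fun p ↦ LinearMap.congr_fun hd p
  refine ⟨d * c * (a * b), (d * c * (a * b)).2, ((c * d : A)) • φ, ψ, fun p ↦ ?_, fun q ↦ ?_⟩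
  · rw [LinearMap.smul_apply, map_smul, mul_comm, mul_smul, hc', smul_smul, smul_smul]
  · rw [LinearMap.smul_apply, mul_smul, hd', smul_smul, smul_smul]
    congr 1
    ring

theorem map_mem_smul_top {R M N : Type*} [CommRing R] [AddCommGroup M] [Module R M]
    [AddCommGroup N] [Module R N] {I : Ideal R} (l : M →ₗ[R] N) {m : M}
    (hm : m ∈ I • (⊤ : Submodule R M)) : l m ∈ I • (⊤ : Submodule R N) := by
  have := Submodule.mem_map_of_mem (f := l) hm
  rw [Submodule.map_smul''] at this
  exact Submodule.smul_mono le_rfl le_top this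

/-- If `g` is regular on `A / I A`, then it is regular on `P / I P` for every projective `P`. -/
theorem mem_smul_top_of_smul_mem {R A P : Type*} [CommRing R] [CommRing A] [Algebra R A]
    [AddCommGroup P] [Module A P] [Module R P] [IsScalarTower R A P] [Module.Projective A P]
    {I : Ideal R} {g : A}
    (hg : ∀ a : A, g * a ∈ I • (⊤ : Submodule R A) → a ∈ I • (⊤ : Submodule R A))
    {p : P} (hp : g • p ∈ I • (⊤ : Submodule R P)) : p ∈ I • (⊤ : Submodule R P) := by
  obtain ⟨s, hs⟩ := Module.projective_def'.mp (inferInstance : Module.Projective A P)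
  have hcoord : ∀ x, s p x ∈ I • (⊤ : Submodule R A) := by
    intro x
    apply hg
    simpa using map_mem_smul_top (((Finsupp.lapply x ∘ₗ s : P →ₗ[A] A)).restrictScalars R) hp
  have := LinearMap.congr_fun hs p
  simp only [LinearMap.comp_apply, Finsupp.linearCombination_apply, LinearMap.id_apply] at this
  rw [← this]
  refine Submodule.sum_mem _ fun x _ ↦ ?_
  exact map_mem_smul_top ((LinearMap.toSpanSingleton A P x).restrictScalars R) (hcoord x)

theorem lTensor_residueField_injective {R M N : Type*} [CommRing R] [IsLocalRing R]
    [AddCommGroup M] [Module R M] [AddCommGroup N] [Module R N] (l : M →ₗ[R] N)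
    (hl : ∀ m, l m ∈ maximalIdeal R • (⊤ : Submodule R N) →
      m ∈ maximalIdeal R • (⊤ : Submodule R M)) :
    Function.Injective (l.lTensor (ResidueField R)) := by
  rw [injective_iff_map_eq_zero]
  intro z hz
  obtain ⟨m, rfl⟩ := TensorProduct.mk_surjective R M (ResidueField R) Ideal.Quotient.mk_surjective z
  have h₁ := LinearMap.ker_tensorProductMk M (I := maximalIdeal R)
  have h₂ := LinearMap.ker_tensorProductMk N (I := maximalIdeal R)
  have : m ∈ LinearMap.ker (TensorProduct.mk R (R ⧸ maximalIdeal R) M 1) := by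
    rw [h₁]
    apply hl
    rw [← h₂]
    exact hz
  exact this

/-- A finite free module over a local ring which is generated over `R[T]` by `c₁, …, cₙ` has an
`R`-basis of the form `Tⁱ cⱼ`, `i < κ j`. -/
theorem exists_basis_of_cyclic_generators {R C : Type*} [CommRing R] [IsLocalRing R]
    [AddCommGroup C] [Module R C] [Module.Finite R C] [Module.Flat R C]
    (T : C →ₗ[R] C) {n : ℕ} (c : Fin n → C)
    (hgen : ∀ U : Submodule R C, (∀ u ∈ U, T u ∈ U) → (∀ j, c j ∈ U) → U = ⊤) :
    ∃ κ : Fin n → ℕ,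
      LinearIndependent R (fun s : (Σ j, Fin (κ j)) ↦ (T ^ (s.2 : ℕ)) (c s.1)) ∧
      Submodule.span R (Set.range fun s : (Σ j, Fin (κ j)) ↦ (T ^ (s.2 : ℕ)) (c s.1)) = ⊤ := by
  classical
  let mk := TensorProduct.mk R (ResidueField R) C 1
  let v : (Σ _ : Fin n, ℕ) → C := fun s ↦ (T ^ s.2) (c s.1)
  let S : (Fin n → ℕ) → Finset (Σ _ : Fin n, ℕ) := fun κ ↦
    Finset.univ.sigma fun j ↦ Finset.range (κ j)
  have mem_S : ∀ κ s, s ∈ S κ ↔ s.2 < κ s.1 := by simp [S]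
  have card_S : ∀ κ, (S κ).card = ∑ j, κ j := by simp [S]
  let D : Set ℕ := {m | ∃ κ, (S κ).card = m ∧ LinearIndepOn (ResidueField R) (mk ∘ v) (S κ : Set _)}
  have hD : BddAbove D := by
    refine ⟨Module.finrank (ResidueField R) (TensorProduct R (ResidueField R) C), ?_⟩
    rintro m ⟨κ, rfl, hκ⟩
    simpa using LinearIndependent.fintype_card_le_finrank hκ
  have hD' : D.Nonempty := ⟨0, 0, by simp [card_S], by
    have : S 0 = ∅ := by simp [S]
    simp [this]⟩
  obtain ⟨κ, hcard, hκ⟩ := Nat.sSup_mem hD' hD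
  have hmax : ∀ j, mk (v ⟨j, κ j⟩) ∈
      Submodule.span (ResidueField R) ((mk ∘ v) '' (S κ : Set _)) := by
    intro j
    by_contra hj
    have hins := LinearIndepOn.insert (x := (⟨j, κ j⟩ : Σ _ : Fin n, ℕ)) hκ hj
    have hS : S (Function.update κ j (κ j + 1)) = insert ⟨j, κ j⟩ (S κ) := by
      ext ⟨l, i⟩
      rw [Finset.mem_insert, mem_S, mem_S]
      rcases eq_or_ne l j with rfl | hl
      · simp
        omega
      · simp [hl]
    have hle : (S (Function.update κ j (κ j + 1))).card ≤ sSup D :=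
      le_csSup hD ⟨_, rfl, by rw [hS, Finset.coe_insert]; exact hins⟩
    rw [hS, Finset.card_insert_of_notMem (by simp [mem_S]), hcard] at hle
    omega
  let W := Submodule.span R (v '' (S κ : Set _))
  have hvW : ∀ j i, i < κ j → v ⟨j, i⟩ ∈ W := fun j i hi ↦
    Submodule.subset_span ⟨⟨j, i⟩, by simpa [mem_S] using hi, rfl⟩
  let U := W ⊔ maximalIdeal R • (⊤ : Submodule R C)
  have hlift : ∀ j, v ⟨j, κ j⟩ ∈ U := by
    intro j
    have h := hmax j
    rw [Set.image_comp, ← Submodule.restrictScalars_mem R, Submodule.restrictScalars_span R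
      (ResidueField R) Ideal.Quotient.mk_surjective, Submodule.span_image] at h
    obtain ⟨y, hy, hyv⟩ := h
    have : v ⟨j, κ j⟩ - y ∈ maximalIdeal R • (⊤ : Submodule R C) := by
      rw [← LinearMap.ker_tensorProductMk, LinearMap.mem_ker, map_sub]
      exact sub_eq_zero.mpr hyv.symm
    rw [← add_sub_cancel y (v ⟨j, κ j⟩)]
    exact Submodule.add_mem_sup hy this
  have hU : U = ⊤ := by
    apply hgen
    · suffices U ≤ U.comap T from fun u hu ↦ this hu
      refine sup_le (Submodule.span_le.mpr ?_) fun x hx ↦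
        Submodule.mem_sup_right (map_mem_smul_top T hx)
      rintro _ ⟨⟨j, i⟩, hi, rfl⟩
      have hi : i < κ j := by simpa [mem_S] using hi
      have hT : T (v ⟨j, i⟩) = v ⟨j, i + 1⟩ := by simp [v, pow_succ']
      change T (v ⟨j, i⟩) ∈ U
      rw [hT]
      rcases (Nat.succ_le_of_lt hi).eq_or_lt with h | h
      · rw [show i + 1 = κ j from h]
        exact hlift j
      · exact Submodule.mem_sup_left (hvW j _ h)
    · intro j
      have hc : c j = v ⟨j, 0⟩ := by simp [v]
      rw [hc]
      rcases Nat.eq_zero_or_pos (κ j) with h | h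
      · have := hlift j
        rwa [h] at this
      · exact Submodule.mem_sup_left (hvW j _ h)
  have hW : W = ⊤ := by
    rw [eq_top_iff]
    exact Submodule.le_of_le_smul_of_le_jacobson_bot Module.Finite.fg_top
      (by rw [jacobson_eq_maximalIdeal]; exact bot_ne_top) hU.ge
  let e : (Σ j, Fin (κ j)) → (S κ : Set (Σ _ : Fin n, ℕ)) := fun s ↦
    ⟨⟨s.1, s.2⟩, by simp [mem_S]⟩
  have he : Function.Injective e := by
    rintro ⟨j, i⟩ ⟨j', i'⟩ h
    simp only [e, Subtype.mk.injEq, Sigma.mk.injEq, heq_eq_eq] at h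
    obtain ⟨rfl, h⟩ := h
    simp [Fin.ext_iff, h]
  refine ⟨κ, ?_, ?_⟩
  · exact Module.IsLocalRing.linearIndependent_of_flat _ (hκ.comp e he)
  · rw [eq_top_iff, ← hW]
    refine Submodule.span_mono ?_
    rintro _ ⟨⟨j, i⟩, hi, rfl⟩
    exact ⟨⟨j, ⟨i, by simpa [mem_S] using hi⟩⟩, rfl⟩

/-- The cokernel of one factor of a factorization of multiplication by `g` is finite free over `R`. -/
theorem free_quotient_range {R A P Q : Type*} [CommRing R] [IsNoetherianRing R] [IsLocalRing R]
    [CommRing A] [Algebra R A] [AddCommGroup P] [Module A P] [Module R P] [IsScalarTower R A P]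
    [Module.Projective A P] [AddCommGroup Q] [Module A Q] [Module R Q] [IsScalarTower R A Q]
    [Module.Projective A Q] [Module.Finite A Q] {g : A}
    (hg : ∀ a : A, g * a ∈ maximalIdeal R • (⊤ : Submodule R A) →
      a ∈ maximalIdeal R • (⊤ : Submodule R A))
    [Module.Finite R (A ⧸ Ideal.span {g})] [Module.Flat R (A ⧸ Ideal.span {g})]
    {φ : P →ₗ[A] Q} {ψ : Q →ₗ[A] P} (hψφ : ∀ p, ψ (φ p) = g • p) (hφψ : ∀ q, φ (ψ q) = g • q) :
    Module.Finite R (Q ⧸ LinearMap.range φ) ∧ Module.Free R (Q ⧸ LinearMap.range φ) := by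
  let I : Ideal A := Ideal.span {g}
  let e : TensorProduct A (A ⧸ I) Q ≃ₗ[R] Q ⧸ (I • ⊤ : Submodule A Q) :=
    (TensorProduct.quotTensorEquivQuotSMul Q I).restrictScalars R
  have : Module.Finite R (TensorProduct A (A ⧸ I) Q) := Module.Finite.trans (A ⧸ I) _
  have : Module.Flat R (TensorProduct A (A ⧸ I) Q) := Module.Flat.trans R (A ⧸ I) _
  have hfin : Module.Finite R (Q ⧸ (I • ⊤ : Submodule A Q)) := Module.Finite.equiv e
  have : Module.Flat R (Q ⧸ (I • ⊤ : Submodule A Q)) := Module.Flat.of_linearEquiv e.symm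
  have hfree : Module.Free R (Q ⧸ (I • ⊤ : Submodule A Q)) := Module.free_of_flat_of_isLocalRing
  have mem_I : ∀ q, q ∈ (I • ⊤ : Submodule A Q) ↔ ∃ q', g • q' = q := fun q ↦ by
    simp [I, Submodule.ideal_span_singleton_smul, Submodule.mem_smul_pointwise_iff_exists]
  have hle : (I • ⊤ : Submodule A Q) ≤ LinearMap.range φ := fun q hq ↦ by
    obtain ⟨q', rfl⟩ := (mem_I q).mp hq
    exact ⟨ψ q', hφψ q'⟩
  let π : (Q ⧸ (I • ⊤ : Submodule A Q)) →ₗ[R] Q ⧸ LinearMap.range φ :=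
    (Submodule.factor hle).restrictScalars R
  have hπ : Function.Surjective π := Submodule.factor_surjective hle
  refine ⟨Module.Finite.of_surjective π hπ, ?_⟩
  refine Module.free_of_lTensor_residueField_injective (LinearMap.ker π).subtype π hπ
    (LinearMap.exact_subtype_ker_map π) (lTensor_residueField_injective _ ?_)
  rintro ⟨x, hx⟩ hxm
  let mkI : Q →ₗ[R] Q ⧸ (I • ⊤ : Submodule A Q) := (Submodule.mkQ _).restrictScalars R
  have hmkI : Function.Surjective mkI := Submodule.mkQ_surjective _
  obtain ⟨y, hy, hyx⟩ : ∃ y ∈ maximalIdeal R • (⊤ : Submodule R Q), mkI y = x := by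
    have : x ∈ (maximalIdeal R • (⊤ : Submodule R Q)).map mkI := by
      rw [Submodule.map_smul'', Submodule.map_top, LinearMap.range_eq_top.mpr hmkI]
      exact hxm
    exact this
  obtain ⟨p, rfl⟩ : y ∈ LinearMap.range φ := by
    rw [← Submodule.Quotient.mk_eq_zero]
    have : π (mkI y) = 0 := by rw [hyx]; exact hx
    exact this
  have hp : p ∈ maximalIdeal R • (⊤ : Submodule R P) := by
    apply mem_smul_top_of_smul_mem hg
    rw [← hψφ]
    exact map_mem_smul_top (ψ.restrictScalars R) hy
  have hmem : ∀ p, mkI (φ p) ∈ LinearMap.ker π := fun p ↦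
    (Submodule.Quotient.mk_eq_zero _).mpr ⟨p, rfl⟩
  have := map_mem_smul_top ((mkI ∘ₗ φ.restrictScalars R).codRestrict _ hmem) hp
  convert this
  exact hyx.symm

/-- Along a factorization of multiplication by `g`, a generating family of `Q` yields one of `P` of the
same size: the relations expressing `x ^ κ j • v j` through the basis of the cokernel generate `P`. -/
theorem exists_span_eq_top {R A P Q : Type*} [CommRing R] [IsNoetherianRing R] [IsLocalRing R]
    [CommRing A] [Algebra R A] [AddCommGroup P] [Module A P] [Module R P] [IsScalarTower R A P]
    [Module.Projective A P] [AddCommGroup Q] [Module A Q] [Module R Q] [IsScalarTower R A Q]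
    [Module.Projective A Q] [Module.Finite A Q] {g : A}
    (hg : ∀ a : A, g * a ∈ maximalIdeal R • (⊤ : Submodule R A) →
      a ∈ maximalIdeal R • (⊤ : Submodule R A))
    (hg₀ : g ∈ nonZeroDivisors A)
    [Module.Finite R (A ⧸ Ideal.span {g})] [Module.Flat R (A ⧸ Ideal.span {g})]
    {x : A} {G : R[X]} (hgG : aeval x G = g) (hx : ∀ a : A, ∃ (f : R[X]) (b : A), a = aeval x f + g * b)
    {φ : P →ₗ[A] Q} {ψ : Q →ₗ[A] P} (hψφ : ∀ p, ψ (φ p) = g • p) (hφψ : ∀ q, φ (ψ q) = g • q)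
    {n : ℕ} (v : Fin n → Q) (hv : Submodule.span A (Set.range v) = ⊤) :
    ∃ w : Fin n → P, Submodule.span A (Set.range w) = ⊤ := by
  obtain ⟨_, _⟩ := free_quotient_range hg hψφ hφψ
  have hφ : Function.Injective φ := by
    rw [injective_iff_map_eq_zero]
    intro p hp
    have : g • p = 0 := by rw [← hψφ, hp, map_zero]
    have hreg : IsSMulRegular P g := Module.Flat.isSMulRegular_of_nonZeroDivisors hg₀
    exact hreg (by simpa using this)
  let X' : Q →ₗ[R] Q := (LinearMap.lsmul A Q x).restrictScalars R
  let π : Q →ₗ[R] Q ⧸ LinearMap.range φ := (Submodule.mkQ _).restrictScalars R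
  have hπ₀ : ∀ q, π q = 0 ↔ ∃ p, φ p = q := fun q ↦ Submodule.Quotient.mk_eq_zero _
  let T : (Q ⧸ LinearMap.range φ) →ₗ[R] Q ⧸ LinearMap.range φ :=
    (LinearMap.lsmul A _ x).restrictScalars R
  have hπT : ∀ i q, (T ^ i) (π q) = π (x ^ i • q) := by
    intro i
    induction i with
    | zero => simp
    | succ i ih =>
      intro q
      rw [pow_succ', Module.End.mul_apply, ih, pow_succ', mul_smul]
      rfl
  /- A submodule over `R` stable under `x` and containing the generators contains every
  polynomial multiple of them. -/
  have haeval : ∀ (U : Submodule R Q), (∀ u ∈ U, x • u ∈ U) → ∀ (f : R[X]), ∀ u ∈ U,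
      aeval x f • u ∈ U := by
    intro U hU f u hu
    induction f using Polynomial.induction_on' with
    | add f₁ f₂ h₁ h₂ => rw [map_add, add_smul]; exact U.add_mem h₁ h₂
    | monomial i r =>
      rw [aeval_monomial, mul_smul, algebraMap_smul]
      refine U.smul_mem _ ?_
      induction i with
      | zero => simpa
      | succ i ih => rw [pow_succ', mul_smul]; exact hU _ ih
  have htop : ∀ (U : Submodule R Q), (∀ a : A, ∀ j, a • v j ∈ U) → ∀ q, q ∈ U := by
    intro U hU q
    have hq : q ∈ Submodule.span A (Set.range v) := hv ▸ Submodule.mem_top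
    rw [Submodule.mem_span_range_iff_exists_fun] at hq
    obtain ⟨a, rfl⟩ := hq
    exact U.sum_mem fun j _ ↦ hU _ j
  obtain ⟨κ, hli, hsp⟩ := exists_basis_of_cyclic_generators T (fun j ↦ π (v j)) (by
    intro U hU hvU
    have hU' : ∀ u ∈ U.comap π, x • u ∈ U.comap π := fun u hu ↦ hU _ hu
    have := htop (U.comap π) (fun a j ↦ by
      obtain ⟨f, b, rfl⟩ := hx a
      rw [add_smul]
      refine (U.comap π).add_mem (haeval _ hU' f _ (hvU j)) ?_
      have : π ((g * b) • v j) = 0 := (hπ₀ _).mpr ⟨ψ (b • v j), by rw [hφψ, mul_smul]⟩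
      change π _ ∈ U
      rw [this]
      exact U.zero_mem)
    rw [eq_top_iff]
    intro c _
    obtain ⟨q, rfl⟩ := Submodule.mkQ_surjective _ c
    exact this q)
  let y : (Σ j, Fin (κ j)) → Q := fun s ↦ x ^ (s.2 : ℕ) • v s.1
  have hy : (fun s : (Σ j, Fin (κ j)) ↦ (T ^ (s.2 : ℕ)) (π (v s.1))) = π ∘ y :=
    funext fun s ↦ hπT _ _
  rw [hy] at hli hsp
  let W := Submodule.span R (Set.range y)
  have hW₀ : ∀ u ∈ W, π u = 0 → u = 0 := fun u hu h ↦
    (Submodule.disjoint_def.mp (Submodule.range_ker_disjoint hli)) u hu h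
  have hW : ∀ q, ∃ u ∈ W, ∃ p, q = u + φ p := by
    intro q
    have : π q ∈ W.map π := by
      rw [← Submodule.span_image, ← Set.range_comp, hsp]
      trivial
    obtain ⟨u, hu, huq⟩ := this
    obtain ⟨p, hp⟩ := (hπ₀ (q - u)).mp (by rw [map_sub, huq, sub_self])
    exact ⟨u, hu, p, by rw [hp]; abel⟩
  choose r hr w hw using fun j ↦ hW (x ^ κ j • v j)
  refine ⟨w, ?_⟩
  let P' := Submodule.span A (Set.range w)
  let F : Submodule R Q := (P'.map φ).restrictScalars R
  let U := W ⊔ F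
  have hFU : ∀ q ∈ U, π q = 0 → ∃ p ∈ P', φ p = q := by
    intro q hq hq₀
    obtain ⟨u, hu, z, ⟨p, hp, rfl⟩, rfl⟩ := Submodule.mem_sup.mp hq
    have hφp : π (φ p) = 0 := (hπ₀ _).mpr ⟨p, rfl⟩
    have hu₀ : u = 0 := hW₀ u hu (by rwa [map_add, hφp, add_zero] at hq₀)
    exact ⟨p, hp, by rw [hu₀, zero_add]⟩
  have hyU : ∀ j i, i ≤ κ j → x ^ i • v j ∈ U := by
    intro j i hi
    rcases hi.eq_or_lt with rfl | hi
    · rw [hw j]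
      exact Submodule.add_mem_sup (hr j) ⟨w j, Submodule.subset_span ⟨j, rfl⟩, rfl⟩
    · exact Submodule.mem_sup_left (Submodule.subset_span ⟨⟨j, ⟨i, hi⟩⟩, rfl⟩)
  have hxU : ∀ u ∈ U, x • u ∈ U := by
    suffices U ≤ U.comap X' from fun u hu ↦ this hu
    refine sup_le (Submodule.span_le.mpr ?_) ?_
    · rintro _ ⟨⟨j, i⟩, rfl⟩
      change x • x ^ (i : ℕ) • v j ∈ U
      rw [smul_smul, ← pow_succ']
      exact hyU j _ i.2
    · rintro _ ⟨p, hp, rfl⟩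
      exact Submodule.mem_sup_right ⟨x • p, P'.smul_mem _ hp, map_smul _ _ _⟩
  have hvU : ∀ j, v j ∈ U := fun j ↦ by simpa using hyU j 0 (Nat.zero_le _)
  have hgv : ∀ j, ∃ p ∈ P', φ p = g • v j := by
    intro j
    refine hFU _ ?_ ((hπ₀ _).mpr ⟨_, hφψ _⟩)
    rw [← hgG]
    exact haeval U hxU G _ (hvU j)
  have hUtop : ∀ q, q ∈ U := by
    refine htop U fun a j ↦ ?_
    obtain ⟨f, b, rfl⟩ := hx a
    rw [add_smul]
    refine U.add_mem (haeval U hxU f _ (hvU j)) (Submodule.mem_sup_right ?_)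
    obtain ⟨p, hp, hpg⟩ := hgv j
    exact ⟨b • p, P'.smul_mem _ hp, by rw [map_smul, hpg, smul_smul, mul_comm]⟩
  rw [eq_top_iff]
  intro p _
  obtain ⟨p', hp', h⟩ := hFU (φ p) (hUtop _) ((hπ₀ _).mpr ⟨p, rfl⟩)
  exact hφ h ▸ hp'

end

theorem IsSpecialMonic.pow {R : Type*} [CommRing R] {f : R[X]} (hf : IsSpecialMonic f) (N : ℕ) :
    IsSpecialMonic (f ^ N) :=
  ⟨hf.1.pow N, by
    have := hf.2
    rw [coeff_zero_eq_eval_zero] at this ⊢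
    rw [eval_pow, this, one_pow]⟩

theorem IsSpecialMonic.isCoprime_X_pow {R : Type*} [CommRing R] {f : R[X]}
    (hf : IsSpecialMonic f) (m : ℕ) : IsCoprime (X ^ m) f := by
  refine IsCoprime.pow_left ⟨-f.divX, 1, ?_⟩
  have := f.divX_mul_X_add
  rw [hf.2, map_one] at this
  nth_rw 2 [← this]
  ring

section Laurent

variable {R : Type*} [CommRing R] {f : R[X]}

/-- Modulo a special monic polynomial, every Laurent polynomial is a polynomial. -/
theorem exists_eq_toLaurent_add (hf : IsSpecialMonic f) (a : LaurentPolynomial R) :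
    ∃ p q : R[X], a = toLaurent p + toLaurent f * (toLaurent q * a) := by
  obtain ⟨m, a', ha⟩ := a.exists_T_pow
  obtain ⟨u, w, h⟩ := hf.isCoprime_X_pow m
  refine ⟨u * a', w, ?_⟩
  have h' := congr(toLaurent $h)
  simp only [map_add, map_mul, map_one, toLaurent_X_pow] at h'
  rw [map_mul, ha]
  linear_combination -a * h'

theorem toLaurent_mul_eq_zero (hf : IsSpecialMonic f) {a : LaurentPolynomial R}
    (ha : toLaurent f * a = 0) : a = 0 := by
  obtain ⟨m, a', ha'⟩ := a.exists_T_pow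
  have h : f * a' = 0 := toLaurent_injective (by rw [map_mul, ha', ← mul_assoc, ha]; simp)
  rw [hf.1.mul_right_eq_zero_iff] at h
  rw [h, map_zero] at ha'
  exact (LaurentPolynomial.isUnit_T m).mul_left_eq_zero.mp ha'.symm

theorem exists_toLaurent_eq_of_mul_eq (hf : IsSpecialMonic f) {a : LaurentPolynomial R} {p : R[X]}
    (ha : toLaurent f * a = toLaurent p) : ∃ q : R[X], a = toLaurent q ∧ f * q = p := by
  obtain ⟨m, a', ha'⟩ := a.exists_T_pow
  have h : f * a' = p * X ^ m := toLaurent_injective (by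
    rw [map_mul, ha', ← mul_assoc, ha, map_mul, toLaurent_X_pow])
  obtain ⟨q, rfl⟩ : X ^ m ∣ a' := (hf.isCoprime_X_pow m).dvd_of_dvd_mul_left ⟨p, by rw [h, mul_comm]⟩
  have hq : a = toLaurent q := by
    apply (LaurentPolynomial.isUnit_T (R := R) m).mul_left_injective
    simp only
    rw [← ha', map_mul, toLaurent_X_pow, mul_comm]
  exact ⟨q, hq, toLaurent_injective (by rw [map_mul, ← hq, ha])⟩

end Laurent

theorem mem_smul_top_iff_coeff {R : Type*} [CommRing R] {I : Ideal R} {p : R[X]} :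
    p ∈ I • (⊤ : Submodule R R[X]) ↔ ∀ i, p.coeff i ∈ I := by
  refine ⟨fun hp i ↦ by simpa using map_mem_smul_top (lcoeff R i) hp, fun hp ↦ ?_⟩
  rw [p.as_sum_range_C_mul_X_pow]
  refine Submodule.sum_mem _ fun i _ ↦ ?_
  rw [C_mul']
  exact Submodule.smul_mem_smul (hp i) trivial

section Subalgebra

variable {R : Type*} [CommRing R] {f : R[X]} (A : Subalgebra R (LaurentPolynomial R))
  (hA : ∀ p : R[X], p.toLaurent ∈ A)

theorem aeval_toLaurent_X (p : R[X]) :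
    aeval (⟨toLaurent X, hA X⟩ : A) p = ⟨toLaurent p, hA p⟩ := by
  apply Subtype.ext
  have h₁ : (A.val.comp (aeval (⟨toLaurent X, hA X⟩ : A))) = toLaurentAlg := by
    apply Polynomial.algHom_ext
    simp
  exact DFunLike.congr_fun h₁ p

theorem exists_eq_aeval_add (hf : IsSpecialMonic f) (a : A) : ∃ (p : R[X]) (b : A),
    a = aeval (⟨toLaurent X, hA X⟩ : A) p + ⟨toLaurent f, hA f⟩ * b := by
  obtain ⟨p, q, h⟩ := exists_eq_toLaurent_add hf (a : LaurentPolynomial R)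
  refine ⟨p, ⟨toLaurent q, hA q⟩ * a, ?_⟩
  rw [aeval_toLaurent_X]
  exact Subtype.ext h

theorem toLaurent_mem_nonZeroDivisors (hf : IsSpecialMonic f) :
    (⟨toLaurent f, hA f⟩ : A) ∈ nonZeroDivisors A := by
  rw [mem_nonZeroDivisors_iff_left]
  intro a ha
  exact Subtype.ext (toLaurent_mul_eq_zero hf congr(Subtype.val $ha))

theorem exists_aeval_eq_of_mul_eq (hf : IsSpecialMonic f) {a : A} {p : R[X]}
    (ha : ⟨toLaurent f, hA f⟩ * a = aeval (⟨toLaurent X, hA X⟩ : A) p) :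
    ∃ q : R[X], a = aeval (⟨toLaurent X, hA X⟩ : A) q ∧ f * q = p := by
  rw [aeval_toLaurent_X] at ha
  obtain ⟨q, hq, hp⟩ := exists_toLaurent_eq_of_mul_eq hf congr(Subtype.val $ha)
  exact ⟨q, by rw [aeval_toLaurent_X]; exact Subtype.ext hq, hp⟩

theorem mem_smul_top_of_toLaurent_mul_mem (hf : IsSpecialMonic f) (I : Ideal R) (a : A)
    (ha : ⟨toLaurent f, hA f⟩ * a ∈ I • (⊤ : Submodule R A)) :
    a ∈ I • (⊤ : Submodule R A) := by
  let x : A := ⟨toLaurent X, hA X⟩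
  let g : A := ⟨toLaurent f, hA f⟩
  have hdecomp : ∀ y ∈ I • (⊤ : Submodule R A), ∃ p ∈ I • (⊤ : Submodule R R[X]),
      ∃ b ∈ I • (⊤ : Submodule R A), y = aeval x p + g * b := by
    intro y hy
    induction hy using Submodule.smul_induction_on' with
    | smul r hr y _ =>
      obtain ⟨p, b, rfl⟩ := exists_eq_aeval_add A hA hf y
      exact ⟨r • p, Submodule.smul_mem_smul hr trivial, r • b,
        Submodule.smul_mem_smul hr trivial, by rw [smul_add, map_smul, mul_smul_comm]⟩
    | add y _ z _ hy hz =>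
      obtain ⟨p, hp, b, hb, rfl⟩ := hy
      obtain ⟨p', hp', b', hb', rfl⟩ := hz
      exact ⟨p + p', Submodule.add_mem _ hp hp', b + b', Submodule.add_mem _ hb hb', by
        rw [map_add]; ring⟩
  obtain ⟨p, hp, b, hb, h⟩ := hdecomp _ ha
  have hab : g * (a - b) = aeval x p := by rw [mul_sub, h]; ring
  obtain ⟨q, hq, rfl⟩ := exists_aeval_eq_of_mul_eq A hA hf hab
  have hqI : q ∈ I • (⊤ : Submodule R R[X]) := by
    have hzero : f.map (Ideal.Quotient.mk I) * q.map (Ideal.Quotient.mk I) = 0 := by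
      ext i
      rw [← Polynomial.map_mul, coeff_map, coeff_zero, Ideal.Quotient.eq_zero_iff_mem]
      exact mem_smul_top_iff_coeff.mp hp i
    rw [(hf.1.map _).mul_right_eq_zero_iff] at hzero
    refine mem_smul_top_iff_coeff.mpr fun i ↦ ?_
    rw [← Ideal.Quotient.eq_zero_iff_mem, ← coeff_map, hzero, coeff_zero]
  rw [← sub_add_cancel a b, hq]
  exact Submodule.add_mem _ (map_mem_smul_top (aeval x).toLinearMap hqI) hb

theorem nonempty_adjoinRoot_equiv_quotient (hf : IsSpecialMonic f) :
    Nonempty (AdjoinRoot f ≃ₗ[R] A ⧸ Ideal.span {(⟨toLaurent f, hA f⟩ : A)}) := by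
  let x : A := ⟨toLaurent X, hA X⟩
  let I : Ideal A := Ideal.span {⟨toLaurent f, hA f⟩}
  let π : R[X] →ₐ[R] A ⧸ I := (Ideal.Quotient.mkₐ R I).comp (aeval x)
  have hπ : Function.Surjective π := by
    intro y
    obtain ⟨a, rfl⟩ := Ideal.Quotient.mk_surjective y
    obtain ⟨p, b, rfl⟩ := exists_eq_aeval_add A hA hf a
    refine ⟨p, ?_⟩
    change Ideal.Quotient.mk I _ = _
    rw [Ideal.Quotient.eq]
    simp [I, Ideal.mem_span_singleton, x]
  have hker : Ideal.span {f} = RingHom.ker π := by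
    ext p
    rw [Ideal.mem_span_singleton, RingHom.mem_ker]
    change _ ↔ Ideal.Quotient.mk I (aeval x p) = 0
    rw [Ideal.Quotient.eq_zero_iff_mem, Ideal.mem_span_singleton]
    constructor
    · rintro ⟨q, rfl⟩
      exact ⟨aeval x q, by rw [map_mul, aeval_toLaurent_X A hA f]⟩
    · rintro ⟨a, ha⟩
      obtain ⟨q, -, rfl⟩ := exists_aeval_eq_of_mul_eq A hA hf ha.symm
      exact dvd_mul_right f q
  exact ⟨((Ideal.quotientEquivAlgOfEq R hker).trans
    (Ideal.quotientKerAlgEquivOfSurjective hπ)).toLinearEquiv⟩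

end Subalgebra

/-- Let `R` be a commutative Noetherian local ring and `A` a ring with
`R[X] ⊆ A ⊆ R[X,X⁻¹]`.  Let `P`, `Q` be finitely generated projective `A`-modules of
constant rank with `P_f ≅ Q_f` for some special monic `f ∈ R[X]`.  Then `P` and `Q`
have the same minimal number of generators. -/
theorem minGenerators_eq_of_special_monic_iso
    (R : Type) [CommRing R] [IsNoetherianRing R] [IsLocalRing R]
    (A : Subalgebra R (LaurentPolynomial R))
    (hA : ∀ p : R[X], p.toLaurent ∈ A)
    (P Q : Type) [AddCommGroup P] [Module A P] [Module.Finite A P] [Module.Projective A P]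
    [AddCommGroup Q] [Module A Q] [Module.Finite A Q] [Module.Projective A Q]
    (p q : ℕ) (hP : HasConstRank A P p) (hQ : HasConstRank A Q q)
    (f : R[X]) (hf : IsSpecialMonic f)
    (hiso : Nonempty (LocalizedModule (Submonoid.powers (⟨f.toLaurent, hA f⟩ : A)) P
        ≃ₗ[Localization (Submonoid.powers (⟨f.toLaurent, hA f⟩ : A))]
      LocalizedModule (Submonoid.powers (⟨f.toLaurent, hA f⟩ : A)) Q)) :
    minGenerators A P = minGenerators A Q := by
  obtain ⟨e⟩ := hiso
  have : Module.FinitePresentation A P := Module.finitePresentation_of_projective A P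
  have : Module.FinitePresentation A Q := Module.finitePresentation_of_projective A Q
  obtain ⟨_, ⟨N, rfl⟩, φ, ψ, hψφ, hφψ⟩ := exists_hom_comp_eq_smul_id _ (e.restrictScalars A)
  have hfN := hf.pow N
  have hpow : (⟨f.toLaurent, hA f⟩ : A) ^ N = ⟨(f ^ N).toLaurent, hA _⟩ :=
    Subtype.ext (by simp)
  simp only [hpow] at hψφ hφψ
  obtain ⟨e'⟩ := nonempty_adjoinRoot_equiv_quotient A hA hfN
  have := hfN.1.finite_adjoinRoot
  have := hfN.1.free_adjoinRoot
  have := Module.Finite.equiv e'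
  have := Module.Flat.of_linearEquiv e'.symm
  let _ : Module R P := Module.compHom P (algebraMap R A)
  let _ : Module R Q := Module.compHom Q (algebraMap R A)
  have : IsScalarTower R A P := IsScalarTower.of_algebraMap_smul fun _ _ ↦ rfl
  have : IsScalarTower R A Q := IsScalarTower.of_algebraMap_smul fun _ _ ↦ rfl
  have h₁ := mem_smul_top_of_toLaurent_mul_mem A hA hfN (IsLocalRing.maximalIdeal R)
  have h₂ := toLaurent_mem_nonZeroDivisors A hA hfN
  have h₃ := exists_eq_aeval_add A hA hfN
  have h₄ := aeval_toLaurent_X A hA (f ^ N)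
  unfold minGenerators
  congr 1
  ext n
  exact ⟨fun ⟨v, hv⟩ ↦ exists_span_eq_top h₁ h₂ h₄ h₃ hφψ hψφ v hv,
    fun ⟨v, hv⟩ ↦ exists_span_eq_top h₁ h₂ h₄ h₃ hψφ hφψ v hv⟩
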